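/- Let f : ℝ^{d_x} × ℝ^{d_y} → ℝ be differentiable, L_f-Lipschitz with ‖∇_x f‖, ‖∇_y f‖ ≤ L_f, and with L_g-Lipschitz gradient; let y* : ℝ^{d_x} → ℝ^{d_y} be L_y-Lipschitz; let μ > 0, and suppose F(x₀) − inf_x F(x) ≤ Δ for F(x) = f(x, y*(x)) and a given x₀. Suppose k₁, k₂ > 0 are constants such that for every L-Lipschitz scalar h : ℝ^{d_x} → ℝ: (a) ∇h_μ is (k₁ L √d_x / μ)-Lipschitz where h_μ(x) = E_{u ~ U(B^{d_x})}[h(x+μu)], and (b) E_{v ~ U(S^{d_x})}‖(d_x/2μ)(h(x+μv) − h(x−μv)) v‖² ≤ k₂ d_x L². Set L_F = L_g(1+L_y)² + k₁ L_f L_y √d_x/μ, C_p = L_g(1+L_y)L_y, σ² = k₂ d_x L_f² L_y² + L_f²(1+2L_y), and α = √(2(Δ + 2 L_f L_y μ)/(T L_F σ²)) for a given T ≥ 1. Let v₀,…,v_{T−1} be i.i.d. uniform on S^{d_x} and define the random iterates x_{t+1} = x_t − α g_t, where g_t = ∇_x f(x_t, y*(x_t)) + H_tᵀ ∇_y f(x_t,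 y*(x_t)) and H_t = (d_x/2μ)(y*(x_t + μ v_t) − y*(x_t − μ v_t)) v_tᵀ. Define ḡ(x) = ∇_x f(x, y*(x)) + Jac y_μ(x)ᵀ ∇_y f(x, y*(x)). Then (1/T) Σ_{t=0}^{T−1} E[‖ḡ(x_t)‖²] ≤ 2√(2(Δ + 2 L_f L_y μ) L_F σ² / T) + C_p² μ². -/

import Mathlib

open MeasureTheory Metric
open scoped InnerProductSpace RealInnerProductSpace NNReal

noncomputable section

/-- `ℝ^n` with the Euclidean norm. -/
abbrev E (n : ℕ) : Type := EuclideanSpace ℝ (Fin n)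

/-- Uniform (normalized Lebesgue) probability measure on the closed unit ball of `ℝ^n`. -/
def uniformBall (n : ℕ) : Measure (E n) :=
  (volume (closedBall (0 : E n) 1))⁻¹ • volume.restrict (closedBall (0 : E n) 1)

/-- Uniform (rotation-invariant) probability measure on the unit sphere of `ℝ^n`,
viewed as a measure on the ambient space. -/
def uniformSphere (n : ℕ) : Measure (E n) :=
  ((volume : Measure (E n)).toSphere Set.univ)⁻¹ •
    Measure.map Subtype.val ((volume : Measure (E n)).toSphere)

/-- Ball smoothing `y_μ` of a map `y : ℝ^{d_x} → ℝ^{d_y}`: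
`y_μ(x) = E_{u ~ U(B^{d_x})}[y(x + μ u)]`. -/
def ymu {dx dy : ℕ} (y : E dx → E dy) (μ : ℝ) (x : E dx) : E dy :=
  ∫ u, y (x + μ • u) ∂(uniformBall dx)

/-- Partial gradient `∇_x f` of `f : ℝ^{d_x} × ℝ^{d_y} → ℝ` in its first argument. -/
def gradx {dx dy : ℕ} (f : E dx × E dy → ℝ) (x : E dx) (y : E dy) : E dx :=
  gradient (fun x' => f (x', y)) x

/-- Partial gradient `∇_y f` of `f : ℝ^{d_x} × ℝ^{d_y} → ℝ` in its second argument. -/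
def grady {dx dy : ℕ} (f : E dx × E dy → ℝ) (x : E dx) (y : E dy) : E dy :=
  gradient (fun y' => f (x, y')) y

/-- Smoothed surrogate `F_μ(x) = f(x, y_μ(x))`. -/
def Fmu {dx dy : ℕ} (f : E dx × E dy → ℝ) (y : E dx → E dy) (μ : ℝ) (x : E dx) : ℝ :=
  f (x, ymu y μ x)

section Auxiliary

open Filter Topology Set

/-- The open shell between the spheres of radius `1` and `1 + ε`. -/
def shell (V : Type*) [NormedAddCommGroup V] (ε : ℝ) : Set V := {x | 1 < ‖x‖ ∧ ‖x‖ < 1 + ε}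

lemma measurableSet_shell {V : Type*} [NormedAddCommGroup V] [MeasurableSpace V]
    [OpensMeasurableSpace V] (ε : ℝ) : MeasurableSet (shell V ε) :=
  (isOpen_lt continuous_const continuous_norm).inter
    (isOpen_lt continuous_norm continuous_const) |>.measurableSet

/-- The radial cutoff equal to `1` on the unit ball and to `0` outside the ball of
radius `1 + ε`. -/
def cutoff {V : Type*} [NormedAddCommGroup V] (ε : ℝ) (x : V) : ℝ :=
  max 0 (min 1 ((1 + ε - ‖x‖) / ε))

lemma lipschitzWith_cutoff {V : Type*} [NormedAddCommGroup V] {ε : ℝ} (hε : 0 < ε) :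
    LipschitzWith (Real.toNNReal ε⁻¹) (cutoff (V := V) ε) := by
  have : LipschitzWith (Real.toNNReal ε⁻¹) fun x : V => (1 + ε - ‖x‖) / ε :=
    LipschitzWith.of_dist_le_mul fun x y => by
      rw [Real.coe_toNNReal _ (by positivity), Real.dist_eq, ← sub_div, abs_div, abs_of_pos hε,
        div_eq_inv_mul]
      gcongr
      rw [dist_eq_norm, show 1 + ε - ‖x‖ - (1 + ε - ‖y‖) = -(‖x‖ - ‖y‖) by ring, abs_neg]
      exact abs_norm_sub_norm_le x y
  exact (this.const_min 1).const_max 0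

lemma hasCompactSupport_cutoff {V : Type*} [NormedAddCommGroup V] [ProperSpace V] {ε : ℝ}
    (hε : 0 < ε) : HasCompactSupport (cutoff (V := V) ε) := by
  refine HasCompactSupport.intro (isCompact_closedBall (0 : V) (1 + ε)) fun x hx => ?_
  have : 1 + ε - ‖x‖ ≤ 0 := by simp at hx; linarith
  rw [cutoff, max_eq_left]
  exact (min_le_right _ _).trans (div_nonpos_of_nonpos_of_nonneg this hε.le)

section LineDeriv

variable {V : Type*} [NormedAddCommGroup V] [InnerProductSpace ℝ V]

lemma hasLineDerivAt_norm {x : V} (hx : x ≠ 0) (e : V) :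
    HasLineDerivAt ℝ (fun y : V => ‖y‖) (⟪‖x‖⁻¹ • x, e⟫) x e := by
  have h := ((hasStrictFDerivAt_norm_sq x).hasFDerivAt.sqrt (by positivity)).hasLineDerivAt e
  simp only [Real.sqrt_sq (norm_nonneg _)] at h
  convert h using 1
  have : ‖x‖ ≠ 0 := norm_ne_zero_iff.2 hx
  simp [real_inner_smul_left]
  field_simp

lemma lineDeriv_cutoff {ε : ℝ} (hε : 0 < ε) (e : V) {x : V} (h1 : ‖x‖ ≠ 1) (h2 : ‖x‖ ≠ 1 + ε) :
    lineDeriv ℝ (cutoff ε) x e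
      = (shell V ε).indicator (fun x => -(ε⁻¹ * ⟪‖x‖⁻¹ • x, e⟫)) x := by
  rcases lt_or_gt_of_ne h1 with h1 | h1
  · have : cutoff (V := V) ε =ᶠ[𝓝 x] fun _ => 1 := by
      filter_upwards [(isOpen_lt continuous_norm continuous_const).mem_nhds h1] with y hy
      have : 1 ≤ (1 + ε - ‖y‖) / ε := by rw [le_div_iff₀ hε]; linarith [mem_ofPred.1 hy]
      simp [cutoff, this]
    rw [this.lineDeriv_eq, indicator_of_notMem fun h => by linarith [h.1]]
    simp [lineDeriv]
  rcases lt_or_gt_of_ne h2 with h2 | h2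
  · have : cutoff (V := V) ε =ᶠ[𝓝 x] fun y => (1 + ε - ‖y‖) / ε := by
      filter_upwards [(isOpen_lt continuous_norm continuous_const).mem_nhds h2,
        (isOpen_lt continuous_const continuous_norm).mem_nhds h1] with y hy hy'
      have hy := mem_ofPred.1 hy
      have hy' := mem_ofPred.1 hy'
      have h3 : (1 + ε - ‖y‖) / ε ≤ 1 := by rw [div_le_one hε]; linarith
      have h4 : 0 ≤ (1 + ε - ‖y‖) / ε := div_nonneg (by linarith) hε.le
      simp [cutoff, h3, h4]
    rw [this.lineDeriv_eq, indicator_of_mem (show x ∈ shell V ε from ⟨h1, h2⟩)]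
    have hx : x ≠ 0 := by rintro rfl; simp at h1; linarith
    have : HasLineDerivAt ℝ (fun y : V => (1 + ε - ‖y‖) / ε) (-⟪‖x‖⁻¹ • x, e⟫ / ε) x e :=
      HasDerivAt.div_const (HasDerivAt.const_sub (1 + ε) (hasLineDerivAt_norm hx e)) ε
    rw [this.lineDeriv]; ring
  · have : cutoff (V := V) ε =ᶠ[𝓝 x] fun _ => 0 := by
      filter_upwards [(isOpen_lt continuous_const continuous_norm).mem_nhds h2] with y hy
      have : (1 + ε - ‖y‖) / ε ≤ 0 :=
        div_nonpos_of_nonpos_of_nonneg (by linarith [mem_ofPred.1 hy]) hε.le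
      rw [cutoff, max_eq_left ((min_le_right _ _).trans this)]
    rw [this.lineDeriv_eq, indicator_of_notMem fun h => by linarith [h.2]]
    simp [lineDeriv]

end LineDeriv

section Sphere

variable {V : Type*} [NormedAddCommGroup V] [InnerProductSpace ℝ V] [FiniteDimensional ℝ V]
  [Nontrivial V] [MeasurableSpace V] [BorelSpace V] (ν : Measure V) [ν.IsAddHaarMeasure]

/-- Polar coordinates for the product of a radial function and a function of the direction. -/
lemma integral_radial_mul_angular (k : ℝ → ℝ) (q : V → ℝ) :
    ∫ x, k ‖x‖ * q (‖x‖⁻¹ • x) ∂ν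
      = (∫ v : sphere (0 : V) 1, q v ∂ν.toSphere)
        * ∫ r : Ioi (0 : ℝ), k r ∂Measure.volumeIoiPow (Module.finrank ℝ V - 1) := by
  calc
    _ = ∫ x : ({(0)}ᶜ : Set V), k ‖x.1‖ * q (‖x.1‖⁻¹ • x.1) ∂(ν.comap (↑)) := by
      rw [integral_subtype_comap (measurableSet_singleton _).compl
        fun x ↦ k ‖x‖ * q (‖x‖⁻¹ • x), restrict_compl_singleton]
    _ = ∫ x, q x.1 * k x.2 ∂ν.toSphere.prod (.volumeIoiPow (Module.finrank ℝ V - 1)) := by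
      simpa [mul_comm] using ν.measurePreserving_homeomorphUnitSphereProd.integral_comp
        (Homeomorph.measurableEmbedding _) (fun x => q x.1 * k x.2)
    _ = _ := integral_prod_mul (fun v : sphere (0 : V) 1 => q v) (fun r : Ioi (0 : ℝ) => k r)

lemma measureReal_shell {ε : ℝ} (hε : 0 < ε) :
    ν.real (shell V ε) = ((1 + ε) ^ Module.finrank ℝ V - 1) * ν.real (ball 0 1) := by
  have h : shell V ε = ball (0 : V) (1 + ε) \ closedBall 0 1 := by
    ext x; simp [shell, and_comm]
  rw [h, measureReal_sdiff (closedBall_subset_ball (by linarith)) measurableSet_closedBall,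
    ← Measure.addHaar_real_closedBall_eq_addHaar_real_ball,
    Measure.addHaar_real_closedBall ν _ (by linarith),
    Measure.addHaar_real_closedBall ν _ zero_le_one]
  simp; ring

lemma setIntegral_shell_angular {ε : ℝ} (hε : 0 < ε) (q : V → ℝ) :
    ∫ x in shell V ε, q (‖x‖⁻¹ • x) ∂ν
      = ((1 + ε) ^ Module.finrank ℝ V - 1) / Module.finrank ℝ V
        * ∫ v : sphere (0 : V) 1, q v ∂ν.toSphere := by
  set k : ℝ → ℝ := (Ioo 1 (1 + ε)).indicator 1
  have key : ∀ q : V → ℝ, ∫ x in shell V ε, q (‖x‖⁻¹ • x) ∂ν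
      = ∫ x, k ‖x‖ * q (‖x‖⁻¹ • x) ∂ν := by
    intro q
    rw [← integral_indicator (measurableSet_shell ε)]
    congr 1; ext x
    by_cases hx : 1 < ‖x‖ ∧ ‖x‖ < 1 + ε <;> simp [k, indicator, shell, hx]
  have h1 := (key fun _ => 1).symm.trans
    (show _ = ((1 + ε) ^ Module.finrank ℝ V - 1) * ν.real (ball 0 1) by
      simp [measureReal_shell ν hε])
  rw [integral_radial_mul_angular ν k fun _ => 1] at h1
  rw [key, integral_radial_mul_angular]
  have hB : 0 < ν.real (ball (0 : V) 1) := ENNReal.toReal_pos (measure_ball_pos ν _ one_pos).ne'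
    measure_ball_lt_top.ne
  have hd : (0 : ℝ) < Module.finrank ℝ V := by exact_mod_cast Module.finrank_pos
  simp only [integral_const, Measure.toSphere_real_apply_univ, smul_eq_mul, mul_one] at h1
  have h2 : Module.finrank ℝ V * ∫ r : Ioi (0 : ℝ), k r
      ∂Measure.volumeIoiPow (Module.finrank ℝ V - 1) = (1 + ε) ^ Module.finrank ℝ V - 1 := by
    apply mul_right_cancel₀ hB.ne'
    rw [← h1]; ring
  rw [← h2]; field_simp

/-- Averages over thin shells converge to the surface integral. -/
lemma tendsto_setIntegral_shell {p : V → ℝ} (hp : Measurable p) {C M : ℝ}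
    (hM : ∀ x, 1 ≤ ‖x‖ → ‖x‖ ≤ 2 → |p x| ≤ M)
    (hC : ∀ x, 1 ≤ ‖x‖ → ‖x‖ ≤ 2 → |p x - p (‖x‖⁻¹ • x)| ≤ C * (‖x‖ - 1)) :
    Tendsto (fun ε : ℝ => ε⁻¹ * ∫ x in shell V ε, p x ∂ν) (𝓝[>] 0)
      (𝓝 (∫ v : sphere (0 : V) 1, p v ∂ν.toSphere)) := by
  have hd : (0 : ℝ) < Module.finrank ℝ V := by exact_mod_cast Module.finrank_pos
  set d := Module.finrank ℝ V
  have hslope : Tendsto (fun ε : ℝ => ε⁻¹ * ((1 + ε) ^ d - 1)) (𝓝[>] 0) (𝓝 (d : ℝ)) := by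
    have := (hasDerivAt_pow d (1 : ℝ)).tendsto_slope_zero_right
    simpa using this
  have hvol : Tendsto (fun ε : ℝ => ν.real (shell V ε)) (𝓝[>] 0) (𝓝 0) := by
    have : Tendsto (fun ε : ℝ => ((1 + ε) ^ d - 1) * ν.real (ball (0 : V) 1)) (𝓝[>] 0) (𝓝 0) := by
      have h : Continuous fun ε : ℝ => ((1 + ε) ^ d - 1) * ν.real (ball (0 : V) 1) := by fun_prop
      simpa using (h.tendsto 0).mono_left nhdsWithin_le_nhds
    refine this.congr' ?_
    filter_upwards [self_mem_nhdsWithin] with ε hε using (measureReal_shell ν hε).symm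
  have hC0 : 0 ≤ C := by
    obtain ⟨x, hx⟩ := exists_norm_eq V (show (0 : ℝ) ≤ 2 by norm_num)
    have := (abs_nonneg _).trans (hC x (by linarith) (by linarith))
    nlinarith
  have hfin : ∀ ε : ℝ, ν (shell V ε) ≠ ⊤ := fun ε =>
    ne_top_of_le_ne_top (measure_ball_lt_top (μ := ν) (x := 0) (r := 1 + ε)).ne
      (measure_mono fun x hx => by simpa using hx.2)
  have main : Tendsto (fun ε : ℝ => ε⁻¹ * ∫ x in shell V ε, p (‖x‖⁻¹ • x) ∂ν) (𝓝[>] 0)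
      (𝓝 (∫ v : sphere (0 : V) 1, p v ∂ν.toSphere)) := by
    have : Tendsto (fun ε : ℝ => (ε⁻¹ * ((1 + ε) ^ d - 1)) / d
        * ∫ v : sphere (0 : V) 1, p v ∂ν.toSphere) (𝓝[>] 0)
        (𝓝 ((d : ℝ) / d * ∫ v : sphere (0 : V) 1, p v ∂ν.toSphere)) :=
      (hslope.div_const _).mul_const _
    rw [div_self hd.ne', one_mul] at this
    refine this.congr' ?_
    filter_upwards [self_mem_nhdsWithin] with ε hε
    rw [setIntegral_shell_angular ν hε]; ring
  have err : Tendsto (fun ε : ℝ => ε⁻¹ * ∫ x in shell V ε, p x ∂ν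
      - ε⁻¹ * ∫ x in shell V ε, p (‖x‖⁻¹ • x) ∂ν) (𝓝[>] 0) (𝓝 0) := by
    have hb : Tendsto (fun ε : ℝ => C * ν.real (shell V ε)) (𝓝[>] 0) (𝓝 0) := by
      simpa using hvol.const_mul C
    refine squeeze_zero_norm' ?_ hb
    filter_upwards [Ioo_mem_nhdsGT (show (0 : ℝ) < 1 by norm_num)] with ε hε
    have hn : ∀ x ∈ shell V ε, ‖‖x‖⁻¹ • x‖ = 1 := fun x hx => by
      rw [norm_smul, norm_inv, norm_norm, inv_mul_cancel₀ (by linarith [hx.1])]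
    have i1 : IntegrableOn p (shell V ε) ν :=
      Measure.integrableOn_of_bounded (hfin ε) hp.aestronglyMeasurable (M := M) <|
        (ae_restrict_mem (measurableSet_shell ε)).mono fun x hx =>
          hM x hx.1.le (by linarith [hx.2, hε.2])
    have i2 : IntegrableOn (fun x => p (‖x‖⁻¹ • x)) (shell V ε) ν :=
      Measure.integrableOn_of_bounded (hfin ε)
        (hp.comp (measurable_norm.inv.smul measurable_id)).aestronglyMeasurable (M := M) <|
        (ae_restrict_mem (measurableSet_shell ε)).mono fun x hx =>
          hM _ (hn x hx).ge (by rw [hn x hx]; norm_num)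
    rw [← mul_sub, ← integral_sub i1 i2, norm_mul, norm_inv, Real.norm_of_nonneg hε.1.le]
    have := norm_setIntegral_le_of_norm_le_const (μ := ν) (s := shell V ε) (C := C * ε)
      (f := fun x => p x - p (‖x‖⁻¹ • x)) (hfin ε).lt_top (fun x hx => by
        refine (hC x hx.1.le (by linarith [hx.2, hε.2])).trans ?_
        gcongr; linarith [hx.2])
    calc ε⁻¹ * _ ≤ ε⁻¹ * (C * ε * ν.real (shell V ε)) := by gcongr; exact inv_nonneg.2 hε.1.le
      _ = _ := by field_simp [hε.1.ne']
  simpa using err.add main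

/-- The divergence theorem on the unit ball for Lipschitz functions. -/
theorem LipschitzWith.setIntegral_lineDeriv_closedBall {L : ℝ≥0} {a : V → ℝ}
    (ha : LipschitzWith L a) (e : V) :
    ∫ x in closedBall (0 : V) 1, lineDeriv ℝ a x e ∂ν
      = ∫ v : sphere (0 : V) 1, a v * ⟪(v : V), e⟫ ∂ν.toSphere := by
  have lhs : Tendsto (fun ε : ℝ => ∫ x, lineDeriv ℝ a x e * cutoff ε x ∂ν) (𝓝[>] 0)
      (𝓝 (∫ x in closedBall (0 : V) 1, lineDeriv ℝ a x e ∂ν)) := by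
    rw [← integral_indicator measurableSet_closedBall]
    refine tendsto_integral_filter_of_dominated_convergence
      ((closedBall (0 : V) 2).indicator fun _ => L * ‖e‖) ?_ ?_ ?_ ?_
    · filter_upwards [self_mem_nhdsWithin] with ε hε
      exact (aestronglyMeasurable_lineDeriv ha.continuous ν).mul
        (lipschitzWith_cutoff hε).continuous.aestronglyMeasurable
    · filter_upwards [Ioo_mem_nhdsGT (show (0 : ℝ) < 1 by norm_num)] with ε hε
      refine .of_forall fun x => ?_
      by_cases hx : x ∈ closedBall (0 : V) 2
      · rw [indicator_of_mem hx, norm_mul]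
        have h1 : ‖cutoff ε x‖ ≤ 1 := by
          rw [cutoff, Real.norm_of_nonneg (le_max_left _ _)]
          exact max_le zero_le_one (min_le_left _ _)
        calc _ ≤ (L * ‖e‖) * 1 :=
            mul_le_mul (norm_lineDeriv_le_of_lipschitz ℝ ha) h1 (norm_nonneg _) (by positivity)
          _ = _ := mul_one _
      · rw [indicator_of_notMem hx]
        have : (1 + ε - ‖x‖) / ε ≤ 0 :=
          div_nonpos_of_nonpos_of_nonneg (by simp at hx; linarith [hε.2]) hε.1.le
        rw [cutoff, max_eq_left ((min_le_right _ _).trans this)]; simp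
    · exact (integrable_indicator_iff measurableSet_closedBall).2
        (integrableOn_const measure_closedBall_lt_top.ne)
    · refine .of_forall fun x => ?_
      refine tendsto_const_nhds.congr' ?_
      by_cases hx : ‖x‖ ≤ 1
      · filter_upwards [self_mem_nhdsWithin] with ε hε
        have hε : 0 < ε := hε
        have : 1 ≤ (1 + ε - ‖x‖) / ε := by rw [le_div_iff₀ hε]; linarith
        simp [cutoff, this, indicator, hx]
      · push Not at hx
        filter_upwards [Ioo_mem_nhdsGT (sub_pos.2 hx)] with ε hε
        have : (1 + ε - ‖x‖) / ε ≤ 0 :=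
          div_nonpos_of_nonpos_of_nonneg (by linarith [hε.2]) hε.1.le
        rw [cutoff, max_eq_left ((min_le_right _ _).trans this)]
        simp [indicator, hx]
  refine tendsto_nhds_unique lhs ?_
  have hnn : ∀ x : V, 1 ≤ ‖x‖ → ‖‖x‖⁻¹ • x‖ = 1 := fun x hx => by
    rw [norm_smul, norm_inv, norm_norm, inv_mul_cancel₀ (by linarith)]
  have hs : ∀ x : V, 1 ≤ ‖x‖ → |⟪‖x‖⁻¹ • x, e⟫| ≤ ‖e‖ := fun x hx => by
    have := abs_real_inner_le_norm (‖x‖⁻¹ • x) e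
    rwa [hnn x hx, one_mul] at this
  have rhs := tendsto_setIntegral_shell ν (p := fun x => a x * ⟪‖x‖⁻¹ • x, e⟫)
    (C := L * ‖e‖) (M := (|a 0| + L * 2) * ‖e‖) ?_ ?_ ?_
  · have h : ∀ v : sphere (0 : V) 1, a v * ⟪‖(v : V)‖⁻¹ • (v : V), e⟫ = a v * ⟪(v : V), e⟫ := by
      intro v; simp
    simp only [h] at rhs
    refine rhs.congr' ?_
    filter_upwards [self_mem_nhdsWithin] with ε hε
    have hε : 0 < ε := hε
    rw [ha.integral_lineDeriv_mul_eq (lipschitzWith_cutoff hε) (hasCompactSupport_cutoff hε),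
      ← integral_const_mul, ← integral_indicator (measurableSet_shell ε)]
    refine integral_congr_ae ?_
    have n1 := measure_eq_zero_iff_ae_notMem.1 (Measure.addHaar_sphere ν (0 : V) 1)
    have n2 := measure_eq_zero_iff_ae_notMem.1 (Measure.addHaar_sphere ν (0 : V) (1 + ε))
    filter_upwards [n1, n2] with x h1 h2
    rw [lineDeriv_cutoff hε _ (by simpa using h1) (by simpa using h2)]
    by_cases hx : x ∈ shell V ε
    · simp [hx]; ring
    · simp [hx]
  · exact ha.continuous.measurable.mul
      ((measurable_norm.inv.smul measurable_id).inner measurable_const)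
  · intro x h1 h2
    rw [abs_mul]
    have : |a x| ≤ |a 0| + L * 2 := by
      have := ha.dist_le_mul x 0
      rw [Real.dist_eq, dist_zero_right] at this
      have h3 : (L : ℝ) * ‖x‖ ≤ L * 2 := by gcongr
      have := abs_sub_abs_le_abs_sub (a x) (a 0)
      linarith
    exact mul_le_mul this (hs x h1) (abs_nonneg _) (by positivity)
  · intro x h1 h2
    have hx0 : ‖x‖ ≠ 0 := by linarith
    have e1 : ‖‖x‖⁻¹ • x‖⁻¹ • ‖x‖⁻¹ • x = ‖x‖⁻¹ • x := by rw [hnn x h1]; simp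
    simp only [e1, ← sub_mul, abs_mul]
    have := ha.dist_le_mul x (‖x‖⁻¹ • x)
    have e2 : dist x (‖x‖⁻¹ • x) = ‖x‖ - 1 := by
      rw [dist_eq_norm]
      nth_rw 1 [show x = (1 : ℝ) • x by simp]
      rw [← sub_smul, norm_smul,
        Real.norm_of_nonneg (sub_nonneg.2 (inv_le_one_of_one_le₀ h1))]
      field_simp
    rw [Real.dist_eq, e2] at this
    calc _ ≤ (L * (‖x‖ - 1)) * ‖e‖ := mul_le_mul this (hs x h1) (abs_nonneg _) (by
            have : 0 ≤ ‖x‖ - 1 := by linarith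
            positivity)
      _ = _ := by ring

end Sphere

instance (n : ℕ) : IsProbabilityMeasure (uniformBall n) := by
  constructor
  rw [uniformBall, Measure.smul_apply, Measure.restrict_apply_univ, smul_eq_mul]
  exact ENNReal.inv_mul_cancel (measure_closedBall_pos _ _ one_pos).ne' measure_closedBall_lt_top.ne

lemma uniformBall_absolutelyContinuous (n : ℕ) : uniformBall n ≪ volume :=
  (Measure.smul_absolutelyContinuous).trans Measure.restrict_le_self.absolutelyContinuous

lemma ae_uniformBall_norm_le_one (n : ℕ) : ∀ᵐ u ∂uniformBall n, ‖u‖ ≤ 1 := by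
  refine Measure.smul_absolutelyContinuous.ae_le ?_
  filter_upwards [ae_restrict_mem measurableSet_closedBall] with u hu
  simpa using hu

instance (n : ℕ) [NeZero n] : Nontrivial (E n) := by
  unfold E; infer_instance

lemma toSphere_univ_ne_zero (n : ℕ) [NeZero n] :
    (volume : Measure (E n)).toSphere univ ≠ 0 := by
  rw [Measure.measure_univ_ne_zero]
  exact Measure.toSphere_ne_zero _

instance (n : ℕ) [NeZero n] : IsProbabilityMeasure (uniformSphere n) := by
  constructor
  rw [uniformSphere, Measure.smul_apply, Measure.map_apply measurable_subtype_coe .univ,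
    preimage_univ, smul_eq_mul]
  exact ENNReal.inv_mul_cancel (toSphere_univ_ne_zero n) (measure_ne_top _ _)

lemma uniformSphere_zero : uniformSphere 0 = 0 := by
  have : (volume : Measure (E 0)).toSphere = 0 :=
    (Measure.toSphere_eq_zero_iff _).2 inferInstance
  simp [uniformSphere, this]

lemma ae_uniformSphere_norm_eq_one (n : ℕ) : ∀ᵐ v ∂uniformSphere n, ‖v‖ = 1 := by
  refine Measure.smul_absolutelyContinuous.ae_le ?_
  change ∀ᵐ v ∂_, ‖v‖ = 1
  rw [ae_map_iff measurable_subtype_coe.aemeasurable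
    (measurableSet_eq_fun measurable_norm measurable_const)]
  exact .of_forall fun v => by simp

lemma integral_uniformSphere (n : ℕ) (φ : E n → ℝ) :
    ∫ v, φ v ∂uniformSphere n = ((volume : Measure (E n)).toSphere.real univ)⁻¹
      * ∫ v : sphere (0 : E n) 1, φ v ∂(volume : Measure (E n)).toSphere := by
  rw [uniformSphere, integral_smul_measure, ENNReal.toReal_inv,
    (MeasurableEmbedding.subtype_coe isClosed_sphere.measurableSet).integral_map]
  rfl

lemma integral_uniformBall (n : ℕ) (φ : E n → ℝ) :
    ∫ u, φ u ∂uniformBall n = (volume.real (closedBall (0 : E n) 1))⁻¹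
      * ∫ u in closedBall (0 : E n) 1, φ u := by
  rw [uniformBall, integral_smul_measure, ENNReal.toReal_inv]
  rfl

lemma integral_uniformBall_neg (n : ℕ) (φ : E n → ℝ) :
    ∫ u, φ (-u) ∂uniformBall n = ∫ u, φ u ∂uniformBall n := by
  rw [integral_uniformBall, integral_uniformBall, ← integral_indicator measurableSet_closedBall,
    ← integral_indicator measurableSet_closedBall, ← integral_neg_eq_self]
  congr 2; ext u; simp [indicator]

/-- The divergence theorem in normalized form. -/
lemma LipschitzWith.integral_lineDeriv_uniformBall {n : ℕ} [NeZero n] {L : ℝ≥0} {a : E n → ℝ}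
    (ha : LipschitzWith L a) (e : E n) :
    ∫ u, lineDeriv ℝ a u e ∂uniformBall n = n * ∫ v, a v * ⟪v, e⟫ ∂uniformSphere n := by
  rw [integral_uniformBall, integral_uniformSphere,
    ha.setIntegral_lineDeriv_closedBall volume, Measure.toSphere_real_apply_univ,
    ← Measure.addHaar_real_closedBall_eq_addHaar_real_ball]
  have : (n : ℝ) ≠ 0 := NeZero.ne _
  simp
  field_simp

lemma lipschitzWith_comp_add_smul {n : ℕ} {F : Type*} [PseudoMetricSpace F] {L : ℝ≥0}
    {y : E n → F} (hy : LipschitzWith L y) (x : E n) (μ : ℝ) :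
    LipschitzWith (L * ‖μ‖₊) fun u => y (x + μ • u) := by
  refine hy.comp (LipschitzWith.of_dist_le_mul fun u v => ?_)
  simp [dist_eq_norm, ← smul_sub, norm_smul]

section Smoothing

variable {n : ℕ} {F : Type*} [NormedAddCommGroup F] [NormedSpace ℝ F] [FiniteDimensional ℝ F]
  {L : ℝ≥0} {y : E n → F}

lemma LipschitzWith.ae_differentiableAt_add_smul (hy : LipschitzWith L y) (x : E n) {μ : ℝ}
    (hμ : μ ≠ 0) : ∀ᵐ u ∂uniformBall n, DifferentiableAt ℝ y (x + μ • u) := by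
  refine (uniformBall_absolutelyContinuous n).ae_le ?_
  filter_upwards [(lipschitzWith_comp_add_smul hy x μ).ae_differentiableAt (μ := volume)] with u hu
  have h : y = (fun u => y (x + μ • u)) ∘ fun z => μ⁻¹ • (z - x) := by
    ext z; simp [smul_smul, hμ]
  rw [h]
  refine DifferentiableAt.comp _ ?_ (by fun_prop)
  simpa [smul_smul, hμ] using hu

lemma LipschitzWith.integrable_comp_add_smul (hy : LipschitzWith L y) (x : E n) (μ : ℝ) :
    Integrable (fun u => y (x + μ • u)) (uniformBall n) := by
  have hl := lipschitzWith_comp_add_smul hy x μ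
  borelize F
  refine Integrable.of_bound hl.continuous.aestronglyMeasurable (‖y x‖ + (L * ‖μ‖₊ : ℝ≥0)) ?_
  filter_upwards [ae_uniformBall_norm_le_one n] with u hu
  have := hl.norm_sub_le u 0
  have h2 := norm_le_norm_add_norm_sub' (y (x + μ • u)) (y x)
  simp only [smul_zero, add_zero, sub_zero] at this
  have h3 : ((L * ‖μ‖₊ : ℝ≥0) : ℝ) * ‖u‖ ≤ (L * ‖μ‖₊ : ℝ≥0) :=
    mul_le_of_le_one_right (by positivity) hu
  linarith

/-- Ball smoothing of a Lipschitz map is differentiable. -/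
lemma LipschitzWith.hasFDerivAt_smoothing (hy : LipschitzWith L y) (x : E n) {μ : ℝ}
    (hμ : μ ≠ 0) :
    Integrable (fun u => fderiv ℝ y (x + μ • u)) (uniformBall n) ∧
    HasFDerivAt (fun x => ∫ u, y (x + μ • u) ∂uniformBall n)
      (∫ u, fderiv ℝ y (x + μ • u) ∂uniformBall n) x := by
  borelize F
  refine hasFDerivAt_integral_of_dominated_loc_of_lip (s := univ) (bound := fun _ => (L : ℝ))
    univ_mem ?_ (hy.integrable_comp_add_smul x μ) ?_ ?_ (integrable_const _) ?_
  · exact .of_forall fun z => (hy.integrable_comp_add_smul z μ).aestronglyMeasurable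
  · exact ((measurable_fderiv ℝ y).comp (by fun_prop)).aestronglyMeasurable
  · refine .of_forall fun u => ?_
    have : LipschitzWith L fun z => y (z + μ • u) := by
      simpa [Function.comp_def] using hy.comp ((isometry_add_right (μ • u)).lipschitz)
    simpa using this.lipschitzOnWith (s := univ)
  · filter_upwards [hy.ae_differentiableAt_add_smul x hμ] with u hu
    simpa [Function.comp_def] using hu.hasFDerivAt.comp x ((hasFDerivAt_id x).add_const (μ • u))

lemma LipschitzWith.smoothing (hy : LipschitzWith L y) (μ : ℝ) :
    LipschitzWith L fun x => ∫ u, y (x + μ • u) ∂uniformBall n := by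
  refine LipschitzWith.of_dist_le_mul fun a b => ?_
  rw [dist_eq_norm, ← integral_sub (hy.integrable_comp_add_smul a μ)
    (hy.integrable_comp_add_smul b μ)]
  have := norm_integral_le_of_norm_le_const (μ := uniformBall n) (C := L * dist a b)
    (f := fun u => y (a + μ • u) - y (b + μ • u))
    (.of_forall fun u => by simpa [dist_eq_norm] using hy.dist_le_mul (a + μ • u) (b + μ • u))
  simpa using this

lemma LipschitzWith.norm_smoothing_sub_le (hy : LipschitzWith L y) {μ : ℝ} (hμ : 0 ≤ μ)
    (x : E n) : ‖(∫ u, y (x + μ • u) ∂uniformBall n) - y x‖ ≤ L * μ := by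
  have h : (∫ u, y (x + μ • u) ∂uniformBall n) - y x
      = ∫ u, (y (x + μ • u) - y x) ∂uniformBall n := by
    rw [integral_sub (hy.integrable_comp_add_smul x μ) (integrable_const _)]; simp
  rw [h]
  have := norm_integral_le_of_norm_le_const (μ := uniformBall n) (C := L * μ)
    (f := fun u => y (x + μ • u) - y x) (by
      filter_upwards [ae_uniformBall_norm_le_one n] with u hu
      have := hy.norm_sub_le (x + μ • u) x
      rw [add_sub_cancel_left, norm_smul, Real.norm_of_nonneg hμ] at this
      refine this.trans ?_
      gcongr
      exact mul_le_of_le_one_right hμ hu)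
  simpa using this

end Smoothing

/-- The two-point estimator is an unbiased estimator of the derivative of the smoothing. -/
lemma LipschitzWith.integral_twoPoint_mul_inner {n : ℕ} [NeZero n] {L : ℝ≥0} {h : E n → ℝ}
    (hh : LipschitzWith L h) {μ : ℝ} (hμ : μ ≠ 0) (x e : E n) :
    ∫ v, ((n : ℝ) / (2 * μ) * (h (x + μ • v) - h (x - μ • v))) * ⟪v, e⟫ ∂uniformSphere n
      = fderiv ℝ (fun x => ∫ u, h (x + μ • u) ∂uniformBall n) x e := by
  obtain ⟨hint, hd⟩ := hh.hasFDerivAt_smoothing x hμ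
  have hdir : ∫ u, lineDeriv ℝ (fun u => h (x + μ • u)) u e ∂uniformBall n
      = μ * (∫ u, fderiv ℝ h (x + μ • u) ∂uniformBall n) e := by
    rw [ContinuousLinearMap.integral_apply hint, ← integral_const_mul]
    refine integral_congr_ae ?_
    filter_upwards [hh.ae_differentiableAt_add_smul x hμ] with u hu
    have h2 : HasFDerivAt (fun u : E n => x + μ • u) (μ • ContinuousLinearMap.id ℝ (E n)) u :=
      ((hasFDerivAt_id u).const_smul μ).const_add x
    have := (hu.hasFDerivAt.comp u h2).hasLineDerivAt e
    simpa [Function.comp_def] using this.lineDeriv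
  have hneg : ∫ u, lineDeriv ℝ (fun u => h (x + (-μ) • u)) u e ∂uniformBall n
      = -∫ u, lineDeriv ℝ (fun u => h (x + μ • u)) u e ∂uniformBall n := by
    rw [← integral_uniformBall_neg, ← integral_neg]
    congr 1; ext u
    have := deriv_comp_neg (fun t : ℝ => h (x + μ • (u + t • e))) 0
    simp only [lineDeriv]
    rw [neg_zero] at this
    rw [← this]
    congr 1; ext t; congr 2
    simp only [smul_add, smul_neg, neg_smul, neg_neg]
  have d1 := (lipschitzWith_comp_add_smul hh x μ).integral_lineDeriv_uniformBall e
  have d2 := (lipschitzWith_comp_add_smul hh x (-μ)).integral_lineDeriv_uniformBall e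
  have hi : ∀ c : ℝ, Integrable (fun v => h (x + c • v) * ⟪v, e⟫) (uniformSphere n) := by
    intro c
    have hl := lipschitzWith_comp_add_smul hh x c
    refine Integrable.of_bound (hl.continuous.mul
      (continuous_id.inner continuous_const)).aestronglyMeasurable
      ((|h x| + (L * ‖c‖₊ : ℝ≥0)) * ‖e‖) ?_
    filter_upwards [ae_uniformSphere_norm_eq_one n] with v hv
    have h1 := hl.norm_sub_le v 0
    have h2 := norm_le_norm_add_norm_sub' (h (x + c • v)) (h x)
    simp only [smul_zero, add_zero, sub_zero, hv, mul_one, Real.norm_eq_abs] at h1 h2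
    rw [norm_mul, Real.norm_eq_abs]
    refine mul_le_mul (h2.trans (by linarith)) ?_ (norm_nonneg _) (by positivity)
    simpa [hv] using norm_inner_le_norm (𝕜 := ℝ) v e
  rw [hd.fderiv, show (∫ u, fderiv ℝ h (x + μ • u) ∂uniformBall n) e
    = (μ * (∫ u, fderiv ℝ h (x + μ • u) ∂uniformBall n) e
      - -(μ * (∫ u, fderiv ℝ h (x + μ • u) ∂uniformBall n) e)) / (2 * μ) by field_simp; ring,
    ← hdir, ← hneg, d1, d2, ← mul_sub, ← integral_sub (hi μ) (hi (-μ)), mul_div_right_comm,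
    ← integral_const_mul]
  congr 1; ext v
  rw [neg_smul, ← sub_eq_add_neg]; ring

lemma Continuous.integrable_of_ae_mem_isCompact {α : Type*} [TopologicalSpace α]
    [MeasurableSpace α] [OpensMeasurableSpace α] {ν : Measure α} [IsFiniteMeasure ν] {K : Set α}
    (hK : IsCompact K) (hν : ∀ᵐ a ∂ν, a ∈ K) {φ : α → ℝ} (hφ : Continuous φ) :
    Integrable φ ν := by
  obtain ⟨C, hC⟩ := hK.exists_bound_of_continuousOn hφ.continuousOn
  exact Integrable.of_bound hφ.aestronglyMeasurable C (hν.mono fun a ha => hC a ha)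

/-- Resampling one coordinate preserves a product probability measure. -/
lemma measurePreserving_update_pi {ι : Type*} [Fintype ι] [DecidableEq ι] {W : Type*}
    [MeasurableSpace W] (σ : Measure W) [IsProbabilityMeasure σ] (t : ι) :
    MeasurePreserving (fun p : (ι → W) × W => Function.update p.1 t p.2)
      ((Measure.pi fun _ : ι => σ).prod σ) (Measure.pi fun _ : ι => σ) := by
  refine ⟨measurable_update', (Measure.pi_eq fun s hs => ?_).symm⟩
  rw [Measure.map_apply measurable_update' (MeasurableSet.univ_pi hs)]
  have h : (fun p : (ι → W) × W => Function.update p.1 t p.2) ⁻¹' univ.pi s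
      = (univ.pi (Function.update s t univ)) ×ˢ s t := by
    ext ⟨ω, v⟩
    simp only [mem_preimage, mem_univ_pi, mem_prod]
    constructor
    · refine fun h => ⟨fun i => ?_, by simpa using h t⟩
      rcases eq_or_ne i t with rfl | hi
      · simp
      · simpa [hi] using h i
    · rintro ⟨h, hv⟩ i
      rcases eq_or_ne i t with rfl | hi
      · simpa using hv
      · simpa [hi] using h i
  rw [h, Measure.prod_prod, Measure.pi_pi, ← Finset.mul_prod_erase _ _ (Finset.mem_univ t),
    ← Finset.mul_prod_erase _ (fun i => σ (s i)) (Finset.mem_univ t)]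
  simp only [Function.update_self, measure_univ, one_mul]
  rw [mul_comm]
  congr 1
  exact Finset.prod_congr rfl fun i hi => by rw [Function.update_of_ne (Finset.ne_of_mem_erase hi)]

section StochasticIteration

variable {V W : Type*} {step : V → W → V} {T : ℕ} {X : ℕ → (Fin T → W) → V} {x0 : V}

lemma iterate_update (hX0 : ∀ ω, X 0 ω = x0)
    (hX : ∀ (t : Fin T) ω, X (t + 1) ω = step (X t ω) (ω t)) (t : Fin T) (ω : Fin T → W) (v : W)
    {s : ℕ} (hs : s ≤ t) : X s (Function.update ω t v) = X s ω := by
  induction s with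
  | zero => rw [hX0, hX0]
  | succ s ih =>
    have hne : (⟨s, by omega⟩ : Fin T) ≠ t := fun h => by
      have := congrArg Fin.val h
      simp at this
      omega
    have h := hX ⟨s, by omega⟩
    simp only at h
    rw [h, h, ih (by omega), Function.update_of_ne hne]

variable [TopologicalSpace V] [TopologicalSpace W]

lemma continuous_iterate (hstep : Continuous fun p : V × W => step p.1 p.2)
    (hX0 : ∀ ω, X 0 ω = x0)
    (hX : ∀ (t : Fin T) ω, X (t + 1) ω = step (X t ω) (ω t)) {s : ℕ} (hs : s ≤ T) :
    Continuous (X s) := by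
  induction s with
  | zero => exact (continuous_const (y := x0)).congr fun ω => (hX0 ω).symm
  | succ s ih =>
    have h := hstep.comp ((ih (by omega)).prodMk (continuous_apply (⟨s, hs⟩ : Fin T)))
    exact h.congr fun ω => (hX ⟨s, hs⟩ ω).symm

variable [SecondCountableTopology W] [MeasurableSpace W] [BorelSpace W]
  {σ : Measure W} [IsProbabilityMeasure σ] {K : Set W}

/-- Telescoping an expected one-step decrease of `Φ` along a stochastic iteration driven by
independent samples. -/
lemma sum_integral_le_of_expected_decrease (hK : IsCompact K) (hσ : ∀ᵐ v ∂σ, v ∈ K)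
    (hstep : Continuous fun p : V × W => step p.1 p.2) (hX0 : ∀ ω, X 0 ω = x0)
    (hX : ∀ (t : Fin T) ω, X (t + 1) ω = step (X t ω) (ω t)) {Φ G : V → ℝ} (hΦ : Continuous Φ)
    (hG : Continuous G) {c D : ℝ} (hdec : ∀ z, ∫ v, Φ (step z v) ∂σ ≤ Φ z - G z + c)
    (hD : ∀ z, Φ x0 - Φ z ≤ D) :
    ∑ t : Fin T, ∫ ω, G (X t ω) ∂(Measure.pi fun _ : Fin T => σ) ≤ D + T * c := by
  set P := Measure.pi fun _ : Fin T => σ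
  have hKP : IsCompact (univ.pi fun _ : Fin T => K) := isCompact_univ_pi fun _ => hK
  have hP : ∀ᵐ ω ∂P, ω ∈ univ.pi fun _ : Fin T => K := by
    simp only [mem_univ_pi, ae_all_iff]
    exact fun i => Measure.tendsto_eval_ae_ae.eventually hσ
  have hint {φ : (Fin T → W) → ℝ} (hφ : Continuous φ) : Integrable φ P :=
    hφ.integrable_of_ae_mem_isCompact hKP hP
  have hXc {s : ℕ} (hs : s ≤ T) : Continuous (X s) := continuous_iterate hstep hX0 hX hs
  have hone (t : Fin T) : ∫ ω, G (X t ω) ∂P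
      ≤ (∫ ω, Φ (X t ω) ∂P) - (∫ ω, Φ (X (t + 1) ω) ∂P) + c := by
    have hc1 : Continuous fun ω => Φ (X (t + 1) ω) := hΦ.comp (hXc t.2)
    have hc0 : Continuous fun ω => Φ (X t ω) := hΦ.comp (hXc t.2.le)
    have hcG : Continuous fun ω => G (X t ω) := hG.comp (hXc t.2.le)
    have hcs : Continuous fun ω => Φ (X t ω) - G (X t ω) := hc0.sub hcG
    have hmp : MeasurePreserving (fun p : (Fin T → W) × W => Function.update p.1 t p.2)
        (P.prod σ) P := measurePreserving_update_pi σ t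
    have hi : Integrable (fun p : (Fin T → W) × W => Φ (step (X t p.1) p.2)) (P.prod σ) := by
      refine (hmp.integrable_comp_of_integrable (hint hc1)).congr (ae_of_all _ fun p => ?_)
      simp only [Function.comp, hX, iterate_update hX0 hX t p.1 p.2 le_rfl, Function.update_self]
    have h1 : ∫ ω, Φ (X (t + 1) ω) ∂P = ∫ ω, ∫ v, Φ (step (X t ω) v) ∂σ ∂P := by
      rw [← integral_prod _ hi]
      nth_rw 1 [← hmp.map_eq]
      rw [integral_map hmp.measurable.aemeasurable hc1.aestronglyMeasurable]
      refine integral_congr_ae (ae_of_all _ fun p => ?_)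
      simp only [hX, iterate_update hX0 hX t p.1 p.2 le_rfl, Function.update_self]
    have h2 : ∫ ω, Φ (X (t + 1) ω) ∂P ≤ ∫ ω, (Φ (X t ω) - G (X t ω) + c) ∂P := by
      rw [h1]
      exact integral_mono hi.integral_prod_left
        (hint (hcs.add continuous_const)) fun ω => hdec _
    rw [integral_add (hint hcs) (integrable_const _),
      integral_sub (hint hc0) (hint hcG)] at h2
    simp at h2
    linarith
  have htel : ∑ t : Fin T, ((∫ ω, Φ (X t ω) ∂P) - (∫ ω, Φ (X (t + 1) ω) ∂P) + c)
      = (∫ ω, Φ (X 0 ω) ∂P) - (∫ ω, Φ (X T ω) ∂P) + T * c := by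
    rw [Finset.sum_add_distrib, Fin.sum_univ_eq_sum_range
      (fun t => (∫ ω, Φ (X t ω) ∂P) - (∫ ω, Φ (X (t + 1) ω) ∂P)), Finset.sum_range_sub']
    simp
  refine (Finset.sum_le_sum fun t _ => hone t).trans ?_
  rw [htel]
  gcongr
  have hi0 : Integrable (fun ω => Φ (X 0 ω)) P := hint (hΦ.comp (hXc (Nat.zero_le _)))
  have hiT : Integrable (fun ω => Φ (X T ω)) P := hint (hΦ.comp (hXc le_rfl))
  rw [← integral_sub hi0 hiT]
  calc _ ≤ ∫ _, D ∂P := by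
        refine integral_mono (hi0.sub hiT) (integrable_const _) fun ω => ?_
        simp only [hX0]
        exact hD _
    _ = D := by simp

end StochasticIteration

/-- Quadratic upper bound for a function with Lipschitz derivative. -/
lemma le_add_sq_of_lipschitz_fderiv {V : Type*} [NormedAddCommGroup V] [NormedSpace ℝ V]
    {F : V → ℝ} {D : V → V →L[ℝ] ℝ} {L : ℝ} (hF : ∀ z, HasFDerivAt F (D z) z)
    (hD : ∀ a b, ‖D a - D b‖ ≤ L * ‖a - b‖) (x d : V) :
    F (x + d) ≤ F x + D x d + L / 2 * ‖d‖ ^ 2 := by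
  set ψ : ℝ → ℝ := fun t => F (x + t • d) - t * D x d - L / 2 * t ^ 2 * ‖d‖ ^ 2
  have hψ : ∀ t, HasDerivAt ψ (D (x + t • d) d - D x d - L * t * ‖d‖ ^ 2) t := by
    intro t
    have h1 : HasDerivAt (fun t : ℝ => x + t • d) d t := by
      simpa using ((hasDerivAt_id t).smul_const d).const_add x
    have h2 := (hF (x + t • d)).comp_hasDerivAt t h1
    have h3 := (h2.sub ((hasDerivAt_id t).mul_const (D x d))).sub
      ((((hasDerivAt_id t).pow 2).const_mul (L / 2)).mul_const (‖d‖ ^ 2))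
    refine h3.congr_deriv ?_
    simp only [id_eq, one_mul, mul_one, Nat.cast_ofNat, Nat.add_one_sub_one, pow_one]
    ring
  have hanti : AntitoneOn ψ (Icc 0 1) := by
    refine antitoneOn_of_deriv_nonpos (convex_Icc 0 1)
      (fun t _ => (hψ t).continuousAt.continuousWithinAt)
      (fun t _ => (hψ t).differentiableAt.differentiableWithinAt) fun t ht => ?_
    rw [interior_Icc] at ht
    rw [(hψ t).deriv]
    have h1 : D (x + t • d) d - D x d ≤ L * t * ‖d‖ ^ 2 := by
      calc D (x + t • d) d - D x d = (D (x + t • d) - D x) d := rfl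
        _ ≤ ‖(D (x + t • d) - D x) d‖ := Real.le_norm_self _
        _ ≤ ‖D (x + t • d) - D x‖ * ‖d‖ := ContinuousLinearMap.le_opNorm _ _
        _ ≤ (L * ‖x + t • d - x‖) * ‖d‖ := by gcongr; exact hD _ _
        _ = L * t * ‖d‖ ^ 2 := by
          rw [add_sub_cancel_left, norm_smul, Real.norm_of_nonneg ht.1.le]; ring
    linarith
  have := hanti (left_mem_Icc.2 zero_le_one) (right_mem_Icc.2 zero_le_one) zero_le_one
  simp only [ψ] at this
  simp at this
  linarith

/-- Regularity assumptions on the objective `f`, the response map `y` and its smoothings. -/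
structure BilevelRegular {dx dy : ℕ} (f : E dx × E dy → ℝ) (y : E dx → E dy)
    (Lf Lg Ly : ℝ≥0) (μ k1 k2 : ℝ) : Prop where
  diff : Differentiable ℝ f
  norm_gradx_le : ∀ x y, ‖gradx f x y‖ ≤ (Lf : ℝ)
  norm_grady_le : ∀ x y, ‖grady f x y‖ ≤ (Lf : ℝ)
  fderiv_lip : ∀ p q : E dx × E dy, ‖fderiv ℝ f p - fderiv ℝ f q‖ ≤ (Lg : ℝ) * ‖p - q‖
  y_lip : LipschitzWith Ly y
  μ_pos : 0 < μ
  k1_pos : 0 < k1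
  k2_pos : 0 < k2
  gradient_smoothing_lip : ∀ (L : ℝ≥0) (h : E dx → ℝ), LipschitzWith L h → ∀ a b : E dx,
    ‖gradient (fun x => ∫ u, h (x + μ • u) ∂(uniformBall dx)) a
      - gradient (fun x => ∫ u, h (x + μ • u) ∂(uniformBall dx)) b‖
      ≤ k1 * (L : ℝ) * Real.sqrt dx / μ * ‖a - b‖
  twoPoint_sq_le : ∀ (L : ℝ≥0) (h : E dx → ℝ), LipschitzWith L h → ∀ z : E dx,
    (∫ v, ‖(((dx : ℝ) / (2 * μ)) * (h (z + μ • v) - h (z - μ • v))) • v‖ ^ 2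
      ∂(uniformSphere dx)) ≤ k2 * (dx : ℝ) * (L : ℝ) ^ 2

/-- The surrogate gradient `ḡ`. -/
def surrogateGrad {dx dy : ℕ} (f : E dx × E dy → ℝ) (y : E dx → E dy) (μ : ℝ) (z : E dx) :
    E dx :=
  gradx f z (y z)
    + (ContinuousLinearMap.adjoint (fderiv ℝ (ymu y μ) z)) (grady f z (y z))

/-- The stochastic estimator of the surrogate gradient in direction `v`. -/
def stochGrad {dx dy : ℕ} (f : E dx × E dy → ℝ) (y : E dx → E dy) (μ : ℝ) (z v : E dx) :
    E dx :=
  gradx f z (y z)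
    + (ContinuousLinearMap.adjoint
        (((dx : ℝ) / (2 * μ)) •
          ((innerSL ℝ v).smulRight (y (z + μ • v) - y (z - μ • v)))))
        (grady f z (y z))

/-- The gradient of the smoothed surrogate `F_μ`. -/
def FmuGrad {dx dy : ℕ} (f : E dx × E dy → ℝ) (y : E dx → E dy) (μ : ℝ) (z : E dx) : E dx :=
  (InnerProductSpace.toDual ℝ (E dx)).symm ((fderiv ℝ f (z, ymu y μ z)).comp
    ((ContinuousLinearMap.id ℝ (E dx)).prod (fderiv ℝ (ymu y μ) z)))

namespace BilevelRegular

variable {dx dy : ℕ} {f : E dx × E dy → ℝ} {y : E dx → E dy} {Lf Lg Ly : ℝ≥0} {μ k1 k2 : ℝ}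

lemma inner_gradx (H : BilevelRegular f y Lf Lg Ly μ k1 k2) (a : E dx) (b : E dy) (e : E dx) :
    ⟪gradx f a b, e⟫ = fderiv ℝ f (a, b) (e, 0) := by
  have h : HasFDerivAt (fun x : E dx => (x, b)) (ContinuousLinearMap.inl ℝ (E dx) (E dy)) a :=
    hasFDerivAt_prodMk_left a b
  have h2 : HasFDerivAt (fun x' => f (x', b)) _ a := (H.diff (a, b)).hasFDerivAt.comp a h
  rw [gradx, inner_gradient_left, h2.fderiv]
  simp

lemma inner_grady (H : BilevelRegular f y Lf Lg Ly μ k1 k2) (a : E dx) (b e : E dy) :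
    ⟪grady f a b, e⟫ = fderiv ℝ f (a, b) (0, e) := by
  have h : HasFDerivAt (fun x : E dy => (a, x)) (ContinuousLinearMap.inr ℝ (E dx) (E dy)) b :=
    hasFDerivAt_prodMk_right a b
  have h2 : HasFDerivAt (fun x' => f (a, x')) _ b := (H.diff (a, b)).hasFDerivAt.comp b h
  rw [grady, inner_gradient_left, h2.fderiv]
  simp

lemma fderiv_apply (H : BilevelRegular f y Lf Lg Ly μ k1 k2) (a : E dx) (b : E dy) (e : E dx)
    (e' : E dy) : fderiv ℝ f (a, b) (e, e') = ⟪gradx f a b, e⟫ + ⟪grady f a b, e'⟫ := by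
  rw [H.inner_gradx, H.inner_grady, ← map_add]; simp

lemma continuous_fderiv (H : BilevelRegular f y Lf Lg Ly μ k1 k2) : Continuous (fderiv ℝ f) :=
  (LipschitzWith.of_dist_le_mul (K := Lg) fun p q => by
    simpa [dist_eq_norm] using H.fderiv_lip p q).continuous

lemma continuous_gradx (H : BilevelRegular f y Lf Lg Ly μ k1 k2) :
    Continuous fun z => gradx f z (y z) := by
  have h : (fun z => gradx f z (y z)) = fun z => (InnerProductSpace.toDual ℝ (E dx)).symm
      ((fderiv ℝ f (z, y z)).comp (ContinuousLinearMap.inl ℝ (E dx) (E dy))) := by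
    ext1 z
    refine ext_inner_right ℝ fun e => ?_
    rw [H.inner_gradx, InnerProductSpace.toDual_symm_apply]; rfl
  rw [h]
  have := H.continuous_fderiv
  have := H.y_lip.continuous
  refine (LinearIsometryEquiv.continuous _).comp ?_
  fun_prop

lemma continuous_grady (H : BilevelRegular f y Lf Lg Ly μ k1 k2) :
    Continuous fun z => grady f z (y z) := by
  have h : (fun z => grady f z (y z)) = fun z => (InnerProductSpace.toDual ℝ (E dy)).symm
      ((fderiv ℝ f (z, y z)).comp (ContinuousLinearMap.inr ℝ (E dx) (E dy))) := by
    ext1 z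
    refine ext_inner_right ℝ fun e => ?_
    rw [H.inner_grady, InnerProductSpace.toDual_symm_apply]; rfl
  rw [h]
  have := H.continuous_fderiv
  have := H.y_lip.continuous
  refine (LinearIsometryEquiv.continuous _).comp ?_
  fun_prop

lemma hasFDerivAt_ymu (H : BilevelRegular f y Lf Lg Ly μ k1 k2) (z : E dx) :
    HasFDerivAt (ymu y μ) (fderiv ℝ (ymu y μ) z) z :=
  (H.y_lip.hasFDerivAt_smoothing z H.μ_pos.ne').2.differentiableAt.hasFDerivAt

lemma ymu_lip (H : BilevelRegular f y Lf Lg Ly μ k1 k2) : LipschitzWith Ly (ymu y μ) :=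
  H.y_lip.smoothing μ

lemma norm_ymu_sub_le (H : BilevelRegular f y Lf Lg Ly μ k1 k2) (z : E dx) :
    ‖ymu y μ z - y z‖ ≤ Ly * μ :=
  H.y_lip.norm_smoothing_sub_le H.μ_pos.le z

lemma norm_jac_apply_le (H : BilevelRegular f y Lf Lg Ly μ k1 k2) (z e : E dx) :
    ‖fderiv ℝ (ymu y μ) z e‖ ≤ Ly * ‖e‖ :=
  (ContinuousLinearMap.le_opNorm _ _).trans
    (by gcongr; exact norm_fderiv_le_of_lipschitz ℝ H.ymu_lip)

lemma inner_lip (H : BilevelRegular f y Lf Lg Ly μ k1 k2) {w : E dy} (hw : ‖w‖ ≤ Lf) :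
    LipschitzWith (Lf * Ly) fun x => ⟪w, y x⟫ :=
  LipschitzWith.of_dist_le_mul fun a b => by
    rw [Real.dist_eq, ← inner_sub_right]
    calc _ ≤ ‖w‖ * ‖y a - y b‖ := abs_real_inner_le_norm _ _
      _ ≤ Lf * (Ly * dist a b) := by
        rw [← dist_eq_norm]; gcongr; exact H.y_lip.dist_le_mul _ _
      _ = _ := by push_cast; ring

lemma inner_jac (H : BilevelRegular f y Lf Lg Ly μ k1 k2) (w : E dy) (z e : E dx) :
    fderiv ℝ (fun x => ∫ u, ⟪w, y (x + μ • u)⟫ ∂uniformBall dx) z e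
      = ⟪w, fderiv ℝ (ymu y μ) z e⟫ := by
  have h : (fun x => ∫ u, ⟪w, y (x + μ • u)⟫ ∂uniformBall dx) = fun x => ⟪w, ymu y μ x⟫ := by
    ext x
    exact integral_inner (H.y_lip.integrable_comp_add_smul x μ) w
  have h2 : HasFDerivAt (fun x => ⟪w, ymu y μ x⟫) _ z :=
    (innerSL ℝ w).hasFDerivAt.comp z (H.hasFDerivAt_ymu z)
  rw [h, h2.fderiv]
  rfl

lemma abs_inner_jac_sub_le (H : BilevelRegular f y Lf Lg Ly μ k1 k2) {w : E dy}
    (hw : ‖w‖ ≤ Lf) (a b e : E dx) :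
    |⟪w, fderiv ℝ (ymu y μ) a e - fderiv ℝ (ymu y μ) b e⟫|
      ≤ k1 * Lf * Ly * Real.sqrt dx / μ * ‖a - b‖ * ‖e‖ := by
  rw [inner_sub_right, ← H.inner_jac, ← H.inner_jac, ← inner_gradient_left, ← inner_gradient_left,
    ← inner_sub_left]
  refine (abs_real_inner_le_norm _ _).trans ?_
  gcongr
  refine (H.gradient_smoothing_lip _ _ (H.inner_lip hw) a b).trans (le_of_eq ?_)
  push_cast; ring

lemma continuous_inner_jac (H : BilevelRegular f y Lf Lg Ly μ k1 k2) (w : E dy) :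
    Continuous fun z => (InnerProductSpace.toDual ℝ (E dx)).symm
      ((innerSL ℝ w).comp (fderiv ℝ (ymu y μ) z)) := by
  have hl : LipschitzWith (‖w‖₊ * Ly) fun x => ⟪w, y x⟫ :=
    LipschitzWith.of_dist_le_mul fun a b => by
      rw [Real.dist_eq, ← inner_sub_right]
      calc _ ≤ ‖w‖ * ‖y a - y b‖ := abs_real_inner_le_norm _ _
        _ ≤ ‖w‖ * (Ly * dist a b) := by
          rw [← dist_eq_norm]; gcongr; exact H.y_lip.dist_le_mul _ _
        _ = _ := by push_cast; ring
  have h : (fun z => (InnerProductSpace.toDual ℝ (E dx)).symm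
      ((innerSL ℝ w).comp (fderiv ℝ (ymu y μ) z)))
      = gradient (fun x => ∫ u, ⟪w, y (x + μ • u)⟫ ∂uniformBall dx) := by
    ext1 z
    refine ext_inner_right ℝ fun e => ?_
    rw [inner_gradient_left, H.inner_jac, InnerProductSpace.toDual_symm_apply]; rfl
  rw [h]
  have hμ := H.μ_pos
  have hk := H.k1_pos
  refine (LipschitzWith.of_dist_le_mul
    (K := (k1 * ((‖w‖₊ * Ly : ℝ≥0) : ℝ) * Real.sqrt dx / μ).toNNReal) fun a b => ?_).continuous
  rw [Real.coe_toNNReal _ (by positivity), dist_eq_norm, dist_eq_norm]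
  exact H.gradient_smoothing_lip _ _ hl a b

lemma continuous_surrogateGrad (H : BilevelRegular f y Lf Lg Ly μ k1 k2) :
    Continuous (surrogateGrad f y μ) := by
  have h : Continuous fun z => ContinuousLinearMap.adjoint (fderiv ℝ (ymu y μ) z) := by
    rw [continuous_clm_apply]
    intro w
    refine (H.continuous_inner_jac w).congr fun z => ext_inner_right ℝ fun e => ?_
    rw [ContinuousLinearMap.adjoint_inner_left, InnerProductSpace.toDual_symm_apply]; rfl
  exact H.continuous_gradx.add (h.clm_apply H.continuous_grady)

lemma inner_surrogateGrad (H : BilevelRegular f y Lf Lg Ly μ k1 k2) (z e : E dx) :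
    ⟪surrogateGrad f y μ z, e⟫ = fderiv ℝ f (z, y z) (e, fderiv ℝ (ymu y μ) z e) := by
  rw [H.fderiv_apply, surrogateGrad, inner_add_left, ContinuousLinearMap.adjoint_inner_left]

lemma hasFDerivAt_Fmu (H : BilevelRegular f y Lf Lg Ly μ k1 k2) (z : E dx) :
    HasFDerivAt (Fmu f y μ) (InnerProductSpace.toDual ℝ (E dx) (FmuGrad f y μ z)) z := by
  rw [FmuGrad, LinearIsometryEquiv.apply_symm_apply]
  exact (H.diff (z, ymu y μ z)).hasFDerivAt.comp z
    ((hasFDerivAt_id z).prodMk (H.hasFDerivAt_ymu z))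

lemma inner_FmuGrad (z e : E dx) :
    ⟪FmuGrad f y μ z, e⟫ = fderiv ℝ f (z, ymu y μ z) (e, fderiv ℝ (ymu y μ) z e) := by
  rw [FmuGrad, InnerProductSpace.toDual_symm_apply]; rfl

lemma norm_graph_le {c e : ℝ} {u : E dx} {w : E dy} (hc : 0 ≤ c) (hu : ‖u‖ ≤ e)
    (hw : ‖w‖ ≤ c * e) : ‖((u, w) : E dx × E dy)‖ ≤ (1 + c) * e := by
  have : 0 ≤ e := (norm_nonneg _).trans hu
  have : 0 ≤ c * e := by positivity
  exact max_le (by linarith) (by linarith)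

lemma norm_le_of_inner_le {V : Type*} [NormedAddCommGroup V] [InnerProductSpace ℝ V] {x : V}
    {C : ℝ} (hC : 0 ≤ C) (h : ∀ e, ⟪x, e⟫ ≤ C * ‖e‖) : ‖x‖ ≤ C := by
  have := h x
  rw [real_inner_self_eq_norm_sq, sq] at this
  by_contra! hlt
  exact absurd this (not_le.2 (mul_lt_mul_of_pos_right hlt (hC.trans_lt hlt)))

lemma FmuGrad_lip (H : BilevelRegular f y Lf Lg Ly μ k1 k2) (a b : E dx) :
    ‖FmuGrad f y μ a - FmuGrad f y μ b‖
      ≤ (Lg * (1 + Ly) ^ 2 + k1 * Lf * Ly * Real.sqrt dx / μ) * ‖a - b‖ := by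
  have hμ := H.μ_pos
  have hk := H.k1_pos
  refine norm_le_of_inner_le (by positivity) fun e => ?_
  set Ja := fderiv ℝ (ymu y μ) a e
  set Jb := fderiv ℝ (ymu y μ) b e
  have h1 : ⟪FmuGrad f y μ a - FmuGrad f y μ b, e⟫
      = (fderiv ℝ f (a, ymu y μ a) - fderiv ℝ f (b, ymu y μ b)) (e, Ja)
        + ⟪grady f b (ymu y μ b), Ja - Jb⟫ := by
    rw [inner_sub_left, inner_FmuGrad, inner_FmuGrad, sub_apply, H.fderiv_apply b,
      H.fderiv_apply b, inner_sub_right]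
    ring
  have h2 : (fderiv ℝ f (a, ymu y μ a) - fderiv ℝ f (b, ymu y μ b)) (e, Ja)
      ≤ (Lg * ((1 + Ly) * ‖a - b‖)) * ((1 + Ly) * ‖e‖) := by
    refine (Real.le_norm_self _).trans ((ContinuousLinearMap.le_opNorm _ _).trans ?_)
    refine mul_le_mul ((H.fderiv_lip _ _).trans ?_)
      (norm_graph_le Ly.2 le_rfl (H.norm_jac_apply_le a e)) (norm_nonneg _) (by positivity)
    refine mul_le_mul_of_nonneg_left ?_ Lg.2
    exact norm_graph_le Ly.2 le_rfl (H.ymu_lip.norm_sub_le a b)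
  have h3 := (le_abs_self _).trans
    (H.abs_inner_jac_sub_le (H.norm_grady_le b (ymu y μ b)) a b e)
  rw [h1]
  linarith

lemma Fmu_add_le (H : BilevelRegular f y Lf Lg Ly μ k1 k2) (x d : E dx) :
    Fmu f y μ (x + d) ≤ Fmu f y μ x + ⟪FmuGrad f y μ x, d⟫
      + (Lg * (1 + Ly) ^ 2 + k1 * Lf * Ly * Real.sqrt dx / μ) / 2 * ‖d‖ ^ 2 :=
  le_add_sq_of_lipschitz_fderiv H.hasFDerivAt_Fmu (fun a b => by
    rw [← map_sub, LinearIsometryEquiv.norm_map]; exact H.FmuGrad_lip a b) x d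

lemma norm_FmuGrad_sub_le (H : BilevelRegular f y Lf Lg Ly μ k1 k2) (z : E dx) :
    ‖FmuGrad f y μ z - surrogateGrad f y μ z‖ ≤ Lg * (1 + Ly) * Ly * μ := by
  have hμ := H.μ_pos
  refine norm_le_of_inner_le (by positivity) fun e => ?_
  rw [inner_sub_left, inner_FmuGrad, H.inner_surrogateGrad, ← sub_apply]
  refine (Real.le_norm_self _).trans ((ContinuousLinearMap.le_opNorm _ _).trans ?_)
  have h1 : ‖((z, ymu y μ z) : E dx × E dy) - (z, y z)‖ ≤ Ly * μ := by
    simpa using H.norm_ymu_sub_le z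
  calc _ ≤ (Lg * (Ly * μ)) * ((1 + Ly) * ‖e‖) :=
        mul_le_mul ((H.fderiv_lip _ _).trans (by gcongr))
          (norm_graph_le Ly.2 le_rfl (H.norm_jac_apply_le z e)) (norm_nonneg _) (by positivity)
    _ = _ := by ring

lemma norm_surrogateGrad_le (H : BilevelRegular f y Lf Lg Ly μ k1 k2) (z : E dx) :
    ‖surrogateGrad f y μ z‖ ≤ Lf * (1 + Ly) := by
  refine norm_le_of_inner_le (by positivity) fun e => ?_
  rw [H.inner_surrogateGrad, H.fderiv_apply]
  have h1 : ⟪gradx f z (y z), e⟫ ≤ Lf * ‖e‖ := (real_inner_le_norm _ _).trans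
    (by gcongr; exact H.norm_gradx_le _ _)
  have h2 : ⟪grady f z (y z), fderiv ℝ (ymu y μ) z e⟫ ≤ Lf * (Ly * ‖e‖) :=
    (real_inner_le_norm _ _).trans (mul_le_mul (H.norm_grady_le _ _) (H.norm_jac_apply_le z e)
      (norm_nonneg _) Lf.2)
  linarith

lemma abs_objective_sub_Fmu_le (H : BilevelRegular f y Lf Lg Ly μ k1 k2) (hf : LipschitzWith Lf f)
    (z : E dx) : |f (z, y z) - Fmu f y μ z| ≤ Lf * Ly * μ := by
  have hμ := H.μ_pos
  have h := hf.dist_le_mul (z, y z) (z, ymu y μ z)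
  rw [Real.dist_eq] at h
  refine h.trans ?_
  rw [mul_assoc]
  gcongr
  rw [dist_comm]
  simpa [Prod.dist_eq, dist_eq_norm] using H.norm_ymu_sub_le z

lemma stochGrad_eq (z v : E dx) :
    stochGrad f y μ z v = gradx f z (y z) + ((dx : ℝ) / (2 * μ) *
      (⟪grady f z (y z), y (z + μ • v)⟫ - ⟪grady f z (y z), y (z - μ • v)⟫)) • v := by
  rw [stochGrad]
  congr 1
  refine ext_inner_right ℝ fun e => ?_
  rw [ContinuousLinearMap.adjoint_inner_left, inner_smul_left, ← inner_sub_right]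
  simp only [smul_apply, ContinuousLinearMap.smulRight_apply,
    innerSL_apply_apply, inner_smul_right, conj_trivial]
  ring

lemma continuous_stochGrad (H : BilevelRegular f y Lf Lg Ly μ k1 k2) :
    Continuous fun p : E dx × E dx => stochGrad f y μ p.1 p.2 := by
  have h1 := H.continuous_gradx
  have h2 := H.continuous_grady
  have h3 := H.y_lip.continuous
  have h4 := h1.comp (continuous_fst (X := E dx) (Y := E dx))
  have h5 := h2.comp (continuous_fst (X := E dx) (Y := E dx))
  simp only [Function.comp_def] at h4 h5
  simp only [stochGrad_eq]
  fun_prop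

lemma integrable_uniformSphere [NeZero dx] {φ : E dx → ℝ} (hφ : Continuous φ) :
    Integrable φ (uniformSphere dx) :=
  hφ.integrable_of_ae_mem_isCompact (isCompact_sphere (0 : E dx) 1)
    ((ae_uniformSphere_norm_eq_one dx).mono fun v hv => by simpa using hv)

lemma integral_inner_stochGrad [NeZero dx] (H : BilevelRegular f y Lf Lg Ly μ k1 k2)
    (z e : E dx) :
    ∫ v, ⟪e, stochGrad f y μ z v⟫ ∂uniformSphere dx = ⟪e, surrogateGrad f y μ z⟫ := by
  have hy := H.y_lip.continuous
  have h := (H.inner_lip (H.norm_grady_le z (y z))).integral_twoPoint_mul_inner H.μ_pos.ne' z e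
  rw [H.inner_jac] at h
  rw [surrogateGrad, inner_add_right, ContinuousLinearMap.adjoint_inner_right,
    real_inner_comm (grady f z (y z)), ← h]
  simp only [stochGrad_eq, real_inner_comm _ e, inner_add_left, real_inner_smul_left]
  rw [integral_add (integrable_const _) (integrable_uniformSphere (by fun_prop))]
  simp

lemma integral_norm_stochGrad_sq_le [NeZero dx] (H : BilevelRegular f y Lf Lg Ly μ k1 k2)
    (z : E dx) : ∫ v, ‖stochGrad f y μ z v‖ ^ 2 ∂uniformSphere dx
      ≤ k2 * dx * Lf ^ 2 * Ly ^ 2 + Lf ^ 2 * (1 + 2 * Ly) := by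
  have hy := H.y_lip.continuous
  set p := gradx f z (y z) with hp
  set w := grady f z (y z) with hw
  have hpn : ‖p‖ ≤ Lf := H.norm_gradx_le _ _
  have hl := H.inner_lip (H.norm_grady_le z (y z))
  have h := hl.integral_twoPoint_mul_inner H.μ_pos.ne' z p
  rw [H.inner_jac] at h
  have h2 := H.twoPoint_sq_le _ _ hl z
  have hcross : ⟪grady f z (y z), fderiv ℝ (ymu y μ) z p⟫ ≤ Lf * (Ly * Lf) :=
    (real_inner_le_norm _ _).trans (mul_le_mul (H.norm_grady_le _ _)
      ((H.norm_jac_apply_le z p).trans (by gcongr)) (norm_nonneg _) Lf.2)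
  rw [← hw] at h h2 hcross
  have hexp (v : E dx) : ‖stochGrad f y μ z v‖ ^ 2 = ‖p‖ ^ 2
      + 2 * ((dx : ℝ) / (2 * μ) * (⟪w, y (z + μ • v)⟫ - ⟪w, y (z - μ • v)⟫) * ⟪v, p⟫)
      + ‖((dx : ℝ) / (2 * μ) * (⟪w, y (z + μ • v)⟫ - ⟪w, y (z - μ • v)⟫)) • v‖ ^ 2 := by
    rw [stochGrad_eq, norm_add_sq_real, inner_smul_right, real_inner_comm v]
  have hpsq : ‖p‖ ^ 2 ≤ Lf ^ 2 := by gcongr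
  simp only [hexp]
  rw [integral_add (integrable_uniformSphere (by fun_prop))
    (integrable_uniformSphere (by fun_prop)), integral_add (integrable_uniformSphere (by fun_prop))
    (integrable_uniformSphere (by fun_prop)), integral_const_mul, h]
  simp only [integral_const, probReal_univ, one_smul]
  push_cast at h2
  nlinarith

lemma continuous_Fmu (H : BilevelRegular f y Lf Lg Ly μ k1 k2) : Continuous (Fmu f y μ) :=
  continuous_iff_continuousAt.2 fun z => (H.hasFDerivAt_Fmu z).continuousAt

lemma integral_Fmu_step_le [NeZero dx] (H : BilevelRegular f y Lf Lg Ly μ k1 k2) {α LF : ℝ}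
    (hα : 0 ≤ α) (hLF : LF = Lg * (1 + Ly) ^ 2 + k1 * Lf * Ly * Real.sqrt dx / μ) (z : E dx) :
    ∫ v, Fmu f y μ (z - α • stochGrad f y μ z v) ∂uniformSphere dx
      ≤ Fmu f y μ z - α / 2 * ‖surrogateGrad f y μ z‖ ^ 2
        + (α / 2 * (Lg * (1 + Ly) * Ly * μ) ^ 2
          + LF * α ^ 2 / 2 * (k2 * dx * Lf ^ 2 * Ly ^ 2 + Lf ^ 2 * (1 + 2 * Ly))) := by
  have hμ := H.μ_pos
  have hk1 := H.k1_pos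
  have hLF0 : 0 ≤ LF := by rw [hLF]; positivity
  have hc : Continuous (stochGrad f y μ z) :=
    H.continuous_stochGrad.comp (by fun_prop : Continuous fun v : E dx => (z, v))
  have hF := H.continuous_Fmu
  set b := FmuGrad f y μ z
  set q := surrogateGrad f y μ z
  have hmono : ∫ v, Fmu f y μ (z - α • stochGrad f y μ z v) ∂uniformSphere dx
      ≤ ∫ v, (Fmu f y μ z + -α * ⟪b, stochGrad f y μ z v⟫
        + LF * α ^ 2 / 2 * ‖stochGrad f y μ z v‖ ^ 2) ∂uniformSphere dx := by
    refine integral_mono (integrable_uniformSphere (by fun_prop))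
      (integrable_uniformSphere (by fun_prop)) fun v => ?_
    have h := H.Fmu_add_le z (-(α • stochGrad f y μ z v))
    rw [← sub_eq_add_neg, ← hLF, inner_neg_right, inner_smul_right, norm_neg, norm_smul, mul_pow,
      Real.norm_eq_abs, sq_abs] at h
    refine h.trans (le_of_eq ?_)
    ring
  rw [integral_add (integrable_uniformSphere (by fun_prop))
    (integrable_uniformSphere (by fun_prop)), integral_add (integrable_uniformSphere (by fun_prop))
    (integrable_uniformSphere (by fun_prop)), integral_const_mul, integral_const_mul,
    H.integral_inner_stochGrad] at hmono
  simp only [integral_const, probReal_univ, one_smul] at hmono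
  have h2 : LF * α ^ 2 / 2 * ∫ v, ‖stochGrad f y μ z v‖ ^ 2 ∂uniformSphere dx ≤ LF * α ^ 2 / 2 *
      (k2 * dx * Lf ^ 2 * Ly ^ 2 + Lf ^ 2 * (1 + 2 * Ly)) := by
    gcongr; exact H.integral_norm_stochGrad_sq_le z
  have h3 : ‖b - q‖ ^ 2 ≤ (Lg * (1 + Ly) * Ly * μ) ^ 2 := by
    gcongr; exact H.norm_FmuGrad_sub_le z
  have h4 : ‖q‖ ^ 2 ≤ 2 * ⟪b, q⟫ + ‖b - q‖ ^ 2 := by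
    rw [norm_sub_sq_real]; nlinarith [sq_nonneg ‖b‖]
  nlinarith

/-- The gradient of `F_μ` vanishes at a point where the suboptimality bound or the smoothness
constant is zero. -/
lemma FmuGrad_eq_zero (H : BilevelRegular f y Lf Lg Ly μ k1 k2) {LF D : ℝ}
    (hLF : LF = Lg * (1 + Ly) ^ 2 + k1 * Lf * Ly * Real.sqrt dx / μ) {x0 : E dx}
    (hD : ∀ z, Fmu f y μ x0 - Fmu f y μ z ≤ D) (h0 : D * LF = 0) : FmuGrad f y μ x0 = 0 := by
  have hμ := H.μ_pos
  have hk1 := H.k1_pos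
  have hLF0 : 0 ≤ LF := by rw [hLF]; positivity
  set b := FmuGrad f y μ x0 with hb
  have key (β : ℝ) : β * ‖b‖ ^ 2 ≤ D + LF / 2 * β ^ 2 * ‖b‖ ^ 2 := by
    have h := H.Fmu_add_le x0 (-(β • b))
    rw [← hLF, inner_neg_right, inner_smul_right, norm_neg, norm_smul, mul_pow, ← hb,
      Real.norm_eq_abs, sq_abs, real_inner_self_eq_norm_sq] at h
    linarith [hD (x0 + -(β • b))]
  by_contra hne
  have hpos : 0 < ‖b‖ ^ 2 := by positivity
  rcases mul_eq_zero.1 h0 with h | h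
  · have := key (1 / (LF + 1))
    rw [h, zero_add] at this
    have h3 : 1 / (LF + 1) ≤ LF / 2 * (1 / (LF + 1)) ^ 2 := le_of_mul_le_mul_right this hpos
    have h4 : 1 / (LF + 1) = (LF + 1) * (1 / (LF + 1)) ^ 2 := by field_simp
    have h5 : 0 < (1 / (LF + 1)) ^ 2 := by positivity
    nlinarith
  · have := key ((D + 1) / ‖b‖ ^ 2)
    rw [h, div_mul_cancel₀ _ hpos.ne'] at this
    linarith

end BilevelRegular

end Auxiliary

/-- averaged expected squared norm bound for the partial-Goldstein surrogate gradient `ḡ` along the PZOS iterates. -/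
theorem stmt16 (dx dy : ℕ) (f : E dx × E dy → ℝ) (Lf Lg : ℝ≥0)
    (hfdiff : Differentiable ℝ f) (hfLip : LipschitzWith Lf f)
    (hgradx : ∀ (x : E dx) (y : E dy), ‖gradx f x y‖ ≤ (Lf : ℝ))
    (hgrady : ∀ (x : E dx) (y : E dy), ‖grady f x y‖ ≤ (Lf : ℝ))
    (hgradLip : ∀ p q : E dx × E dy, ‖fderiv ℝ f p - fderiv ℝ f q‖ ≤ (Lg : ℝ) * ‖p - q‖)
    (ystar : E dx → E dy) (Ly : ℝ≥0) (hLip : LipschitzWith Ly ystar)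
    (μ : ℝ) (hμ : 0 < μ) (k1 k2 : ℝ) (hk1pos : 0 < k1) (hk2pos : 0 < k2)
    (hk1 : ∀ (L : ℝ≥0) (h : E dx → ℝ), LipschitzWith L h →
      ∀ a b : E dx,
        ‖gradient (fun x => ∫ u, h (x + μ • u) ∂(uniformBall dx)) a
          - gradient (fun x => ∫ u, h (x + μ • u) ∂(uniformBall dx)) b‖
        ≤ k1 * (L : ℝ) * Real.sqrt dx / μ * ‖a - b‖)
    (hk2 : ∀ (L : ℝ≥0) (h : E dx → ℝ), LipschitzWith L h →
      ∀ z : E dx,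
        (∫ v, ‖(((dx : ℝ) / (2 * μ)) * (h (z + μ • v) - h (z - μ • v))) • v‖ ^ 2
          ∂(uniformSphere dx))
        ≤ k2 * (dx : ℝ) * (L : ℝ) ^ 2)
    (LF Cp sig2 : ℝ)
    (hLF : LF = (Lg : ℝ) * (1 + (Ly : ℝ)) ^ 2 + k1 * (Lf : ℝ) * (Ly : ℝ) * Real.sqrt dx / μ)
    (hCp : Cp = (Lg : ℝ) * (1 + (Ly : ℝ)) * (Ly : ℝ))
    (hsig2 : sig2 = k2 * (dx : ℝ) * (Lf : ℝ) ^ 2 * (Ly : ℝ) ^ 2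
      + (Lf : ℝ) ^ 2 * (1 + 2 * (Ly : ℝ)))
    (x0 : E dx) (Δ : ℝ)
    (hΔ : ∀ x : E dx, f (x0, ystar x0) - f (x, ystar x) ≤ Δ)
    (T : ℕ) (hT : 1 ≤ T) (α : ℝ)
    (hα : α = Real.sqrt (2 * (Δ + 2 * (Lf : ℝ) * (Ly : ℝ) * μ) / ((T : ℝ) * LF * sig2)))
    (g : E dx → E dx → E dx)
    (hg : ∀ z v : E dx,
      g z v = gradx f z (ystar z)
        + (ContinuousLinearMap.adjoint
            (((dx : ℝ) / (2 * μ)) •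
              ((innerSL ℝ v).smulRight (ystar (z + μ • v) - ystar (z - μ • v)))))
            (grady f z (ystar z)))
    (X : ℕ → (Fin T → E dx) → E dx)
    (hX0 : ∀ ω : Fin T → E dx, X 0 ω = x0)
    (hXstep : ∀ (t : Fin T) (ω : Fin T → E dx),
      X ((t : ℕ) + 1) ω = X (t : ℕ) ω - α • g (X (t : ℕ) ω) (ω t))
    (gbar : E dx → E dx)
    (hgbar : ∀ z : E dx,
      gbar z = gradx f z (ystar z)
        + (ContinuousLinearMap.adjoint (fderiv ℝ (ymu ystar μ) z)) (grady f z (ystar z))) :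
    (1 / (T : ℝ)) * ∑ t : Fin T,
      ∫ ω, ‖gbar (X (t : ℕ) ω)‖ ^ 2 ∂(Measure.pi fun _ : Fin T => uniformSphere dx)
      ≤ 2 * Real.sqrt (2 * (Δ + 2 * (Lf : ℝ) * (Ly : ℝ) * μ) * LF * sig2 / (T : ℝ))
        + Cp ^ 2 * μ ^ 2 := by
  have H : BilevelRegular f ystar Lf Lg Ly μ k1 k2 :=
    ⟨hfdiff, hgradx, hgrady, hgradLip, hLip, hμ, hk1pos, hk2pos, hk1, hk2⟩
  obtain rfl : gbar = surrogateGrad f ystar μ := funext hgbar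
  obtain rfl : g = stochGrad f ystar μ := funext fun z => funext fun v => hg z v
  set D := Δ + 2 * (Lf : ℝ) * (Ly : ℝ) * μ with hDdef
  have hD (z : E dx) : Fmu f ystar μ x0 - Fmu f ystar μ z ≤ D := by
    have h1 := abs_le.1 (H.abs_objective_sub_Fmu_le hfLip x0)
    have h2 := abs_le.1 (H.abs_objective_sub_Fmu_le hfLip z)
    have h3 := hΔ z
    linarith [h1.1, h2.2]
  have hD0 : 0 ≤ D := by simpa using hD x0
  have hLF0 : 0 ≤ LF := by rw [hLF]; positivity
  have hs0 : 0 ≤ sig2 := by rw [hsig2]; positivity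
  have hT0 : (0 : ℝ) < T := by exact_mod_cast hT
  have hα0 : 0 ≤ α := hα ▸ Real.sqrt_nonneg _
  rcases Nat.eq_zero_or_pos dx with rfl | hdx
  · have : NeZero T := ⟨by omega⟩
    have hP : (Measure.pi fun _ : Fin T => uniformSphere 0) = 0 := by
      rw [← Measure.measure_univ_eq_zero, uniformSphere_zero, Measure.pi_univ]
      simp [NeZero.ne T]
    simp only [hP, integral_zero_measure, Finset.sum_const_zero, mul_zero]
    positivity
  have : NeZero dx := ⟨hdx.ne'⟩
  rcases eq_or_ne (D * LF) 0 with h0 | h0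
  · have hαz : α = 0 := by
      rw [hα]
      rcases mul_eq_zero.1 h0 with h | h <;> simp [h]
    have hX (ω : Fin T → E dx) (t : ℕ) (ht : t ≤ T) : X t ω = x0 := by
      induction t with
      | zero => exact hX0 ω
      | succ t ih =>
        have h := hXstep ⟨t, ht⟩ ω
        simp only at h
        rw [h, ih (by omega), hαz, zero_smul, sub_zero]
    have hb : ‖surrogateGrad f ystar μ x0‖ ≤ Cp * μ := by
      have h := H.norm_FmuGrad_sub_le x0
      rwa [H.FmuGrad_eq_zero hLF hD h0, zero_sub, norm_neg, ← hCp] at h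
    have hsum : ∑ t : Fin T, ∫ ω, ‖surrogateGrad f ystar μ (X t ω)‖ ^ 2
        ∂(Measure.pi fun _ : Fin T => uniformSphere dx)
        = T * ‖surrogateGrad f ystar μ x0‖ ^ 2 := by
      simp [fun (ω : Fin T → E dx) (t : Fin T) => hX ω t t.2.le]
    rw [hsum, ← mul_assoc, one_div_mul_cancel hT0.ne', one_mul, ← mul_pow]
    have : 0 ≤ 2 * Real.sqrt (2 * D * LF * sig2 / T) := by positivity
    have : ‖surrogateGrad f ystar μ x0‖ ^ 2 ≤ (Cp * μ) ^ 2 := by gcongr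
    linarith
  rcases hs0.eq_or_lt with hsz | hs
  · have hLf : (Lf : ℝ) = 0 := by
      have h1 : 0 ≤ k2 * (dx : ℝ) * (Lf : ℝ) ^ 2 * (Ly : ℝ) ^ 2 := by positivity
      have h2 : 0 ≤ (Lf : ℝ) ^ 2 * (Ly : ℝ) := by positivity
      have h3 : (Lf : ℝ) ^ 2 = 0 := le_antisymm (by linarith) (sq_nonneg _)
      exact pow_eq_zero_iff two_ne_zero |>.1 h3
    have hb (z : E dx) : ‖surrogateGrad f ystar μ z‖ = 0 :=
      le_antisymm (by simpa [hLf] using H.norm_surrogateGrad_le z) (norm_nonneg _)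
    simp only [hb, ne_eq, OfNat.ofNat_ne_zero, not_false_eq_true, zero_pow, integral_zero,
      Finset.sum_const_zero, mul_zero]
    positivity
  have hDpos : 0 < D := hD0.lt_of_ne fun h => h0 (by rw [← h, zero_mul])
  have hLFpos : 0 < LF := hLF0.lt_of_ne fun h => h0 (by rw [← h, mul_zero])
  have hαpos : 0 < α := by rw [hα]; positivity
  have hα2 : α ^ 2 * (T * LF * sig2) = 2 * D := by
    rw [hα, Real.sq_sqrt (by positivity)]
    field_simp
  have hR : Real.sqrt (2 * D * LF * sig2 / T) = α * LF * sig2 := by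
    rw [← hα2, ← Real.sqrt_sq (show 0 ≤ α * LF * sig2 by positivity)]
    congr 1
    field_simp
  have hstep : Continuous fun p : E dx × E dx => p.1 - α • stochGrad f ystar μ p.1 p.2 :=
    continuous_fst.sub (H.continuous_stochGrad.const_smul α)
  have hkey := sum_integral_le_of_expected_decrease
    (step := fun z v => z - α • stochGrad f ystar μ z v) (isCompact_sphere (0 : E dx) 1)
    ((ae_uniformSphere_norm_eq_one dx).mono fun v hv => by simpa using hv)
    hstep hX0 hXstep
    H.continuous_Fmu ((H.continuous_surrogateGrad.norm.pow 2).const_mul (α / 2))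
    (H.integral_Fmu_step_le hα0 hLF) hD
  simp only [integral_const_mul, ← Finset.mul_sum] at hkey
  rw [← hsig2, ← hCp] at hkey
  set S := ∑ t : Fin T, ∫ ω, ‖surrogateGrad f ystar μ (X t ω)‖ ^ 2
    ∂(Measure.pi fun _ : Fin T => uniformSphere dx)
  rw [hR, one_div, inv_mul_le_iff₀ hT0]
  refine le_of_mul_le_mul_left ?_ (half_pos hαpos)
  refine hkey.trans (le_of_eq ?_)
  linear_combination (-1 / 2 : ℝ) * hα2
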